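/- For any phase P of the algorithm TC (with α even), OPT(P) ≥ (size(𝓕)/(4·h(T)) − k_P)·α/2, where OPT(P) is the minimum cost of serving the requests of P by an offline algorithm with cache size k_OPT that may start the phase with an arbitrary cache. -/

import Mathlib

open scoped Classical

/-!
Common setup for the online tree caching problem
(Bienkowski, Marcinkowski, Pacut, Schmid, Spyra, "Online Tree Caching").
-/

/-- A finite rooted tree on the vertex type `V`: every vertex has a parent,
the root is its own parent, and iterating `parent` from any vertex reaches the root. -/
structure RTree (V : Type) where
  root : V
  parent : V → V
  parent_root : parent root = root
  reaches_root : ∀ v : V, ∃ n : ℕ, parent^[n] v = root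

namespace RTree

variable {V : Type}

/-- The subtree `T(u)`: `u` together with all its descendants. -/
def subtree (T : RTree V) (u : V) : Set V :=
  {v | ∃ n : ℕ, T.parent^[n] v = u}

/-- `C` is a subforest of `T`: with every node it contains the whole subtree below it. -/
def Subforest (T : RTree V) (C : Set V) : Prop :=
  ∀ v ∈ C, T.subtree v ⊆ C

/-- `A` is a tree cap rooted at `v`: `A ⊆ T(v)`, `v ∈ A`, and `A` is closed under
taking the parent (towards `v`). -/
def TreeCap (T : RTree V) (v : V) (A : Set V) : Prop :=
  A ⊆ T.subtree v ∧ v ∈ A ∧ ∀ u ∈ A, u ≠ v → T.parent u ∈ A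

/-- `X` is a valid positive changeset for the cache `C`. -/
def ValidPos (T : RTree V) (C X : Set V) : Prop :=
  X.Nonempty ∧ X ∩ C = ∅ ∧ T.Subforest (C ∪ X)

/-- `X` is a valid negative changeset for the cache `C`. -/
def ValidNeg (T : RTree V) (C X : Set V) : Prop :=
  X.Nonempty ∧ X ⊆ C ∧ T.Subforest (C \ X)

/-- `X` is a valid changeset for the cache `C`. -/
def Valid (T : RTree V) (C X : Set V) : Prop :=
  T.ValidPos C X ∨ T.ValidNeg C X

/-- `w` is the root of a tree (connected component) of the subforest `C`. -/
def IsCompRoot (T : RTree V) (C : Set V) (w : V) : Prop :=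
  w ∈ C ∧ (w = T.root ∨ T.parent w ∉ C)

/-- The depth of a node: its distance to the root. -/
noncomputable def depth [DecidableEq V] (T : RTree V) (v : V) : ℕ :=
  Nat.find (T.reaches_root v)

/-- The height `h(T)` of the tree: its number of levels. -/
noncomputable def height [Fintype V] [DecidableEq V] (T : RTree V) : ℕ :=
  (Finset.univ.sup fun v => T.depth v) + 1

end RTree

/-- A request: a node together with a sign (`true` = positive, `false` = negative). -/
abbrev Request (V : Type) := V × Bool

/-- The request `r` incurs cost `1` when the cache is `C`
(a positive request to a non-cached node, or a negative request to a cached node). -/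
def Costly {V : Type} (r : Request V) (C : Set V) : Prop :=
  (r.2 = true ∧ r.1 ∉ C) ∨ (r.2 = false ∧ r.1 ∈ C)

/-- The sum of the counters `f` over the set of nodes `A`. -/
noncomputable def cntSum {V : Type} [Fintype V] (f : V → ℕ) (A : Set V) : ℕ :=
  ∑ v : V, A.indicator f v

/-- The number of nodes of a changeset (`0` for no changeset). -/
noncomputable def chgSize {V : Type} : Option (Set V) → ℕ
  | none => 0
  | some X => X.ncard

/-- One phase of the algorithm `TC` on the request sequence `req` (the request of
round `t ≥ 1` is `req t`), starting at time `0` with an empty cache.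
`cache t` is the cache contents during round `t`; `cnt t` are the counter values just
after serving the request of round `t` (used for the decision at time `t`);
`chg t` is the changeset applied at time `t` (right after round `t`), if any. -/
structure TCPhase {V : Type} [Fintype V] [DecidableEq V]
    (T : RTree V) (α : ℕ) (req : ℕ → Request V) where
  cache : ℕ → Set V
  cnt : ℕ → V → ℕ
  chg : ℕ → Option (Set V)
  cache_subforest : ∀ t, T.Subforest (cache t)
  cache_zero : cache 0 = ∅
  cnt_zero : ∀ v, cnt 0 v = 0
  cnt_rec : ∀ t v, cnt (t + 1) v =
    (if ∃ X, chg t = some X ∧ v ∈ X then 0 else cnt t v)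
    + (if (req (t + 1)).1 = v ∧ Costly (req (t + 1)) (cache (t + 1)) then 1 else 0)
  step_some : ∀ t X, chg t = some X →
    T.Valid (cache t) X ∧
    X.ncard * α ≤ cntSum (cnt t) X ∧
    (∀ Y, T.Valid (cache t) Y → X ⊂ Y → cntSum (cnt t) Y < Y.ncard * α) ∧
    cache (t + 1) = if T.ValidPos (cache t) X then cache t ∪ X else cache t \ X
  step_none : ∀ t, chg t = none →
    cache (t + 1) = cache t ∧
    ∀ X, T.Valid (cache t) X → cntSum (cnt t) X < X.ncard * α

namespace TCPhase

variable {V : Type} [Fintype V] [DecidableEq V]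
  {T : RTree V} {α : ℕ} {req : ℕ → Request V}

/-- The counter values at time `t`, right after the cache change at time `t`
(counters of fetched/evicted nodes are reset to `0`). -/
noncomputable def cntPost (E : TCPhase T α req) (t : ℕ) (v : V) : ℕ :=
  if ∃ X, E.chg t = some X ∧ v ∈ X then 0 else E.cnt t v

/-- `last_v(t)`: the last time strictly before `t` at which `v` changed its
cached/non-cached state (`0`, the beginning of the phase, if there is none). -/
noncomputable def lastChg (E : TCPhase T α req) (v : V) (t : ℕ) : ℕ :=
  ((Finset.range t).filter fun s => ¬ ((v ∈ E.cache s) ↔ v ∈ E.cache (s + 1))).sup id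

/-- The slot `(v, r)` belongs to the field `F^t`. -/
def inField (E : TCPhase T α req) (t : ℕ) (v : V) (r : ℕ) : Prop :=
  ∃ X, E.chg t = some X ∧ v ∈ X ∧ E.lastChg v t < r ∧ r ≤ t

/-- The number of requests of the sequence `ρ` lying in slots of `F^t_{≤ τ} ∩ D`. -/
noncomputable def fieldReqIn (E : TCPhase T α req) (ρ : ℕ → Request V)
    (t : ℕ) (D : Set V) (τ : ℕ) : ℕ :=
  ((Finset.Icc 1 t).filter fun r => r ≤ τ ∧ (ρ r).1 ∈ D ∧ E.inField t (ρ r).1 r).card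

/-- `req(F^t)`: the number of requests of `ρ` in slots of the field `F^t`. -/
noncomputable def fieldReq (E : TCPhase T α req) (ρ : ℕ → Request V) (t : ℕ) : ℕ :=
  E.fieldReqIn ρ t Set.univ t

/-- `size(F^t_{≤ τ} ∩ D)`: the number of distinct nodes having a slot in `F^t_{≤ τ} ∩ D`. -/
noncomputable def fieldSizeIn (E : TCPhase T α req) (t : ℕ) (D : Set V) (τ : ℕ) : ℕ :=
  (Finset.univ.filter fun v : V => v ∈ D ∧ ∃ r, r ≤ τ ∧ E.inField t v r).card

/-- The standing assumption: no positive requests are given to cached nodes and no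
negative requests to non-cached ones (so every request incurs cost `1` for `TC`). -/
def GoodReq (E : TCPhase T α req) : Prop :=
  ∀ t, 1 ≤ t →
    ((req t).2 = true → (req t).1 ∉ E.cache t) ∧
    ((req t).2 = false → (req t).1 ∈ E.cache t)

/-- The phase consists of rounds `1, …, tEnd`: no cache of `TC` before time `tEnd`
exceeds the capacity `kONL` (at time `tEnd` the triggered fetch, if any, is performed
even if it exceeds the capacity, and is followed by the final eviction). -/
def PhaseEnd (E : TCPhase T α req) (kONL tEnd : ℕ) : Prop :=
  ∀ t, t < tEnd → (E.cache (t + 1)).ncard ≤ kONL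

/-- `k_P`: the number of nodes in `TC`'s cache at the end of the phase
(after the fetch at time `tEnd`, before the final eviction). -/
noncomputable def kP (E : TCPhase T α req) (tEnd : ℕ) : ℕ :=
  (E.cache (tEnd + 1)).ncard

/-- The phase ending at `tEnd` is finished: the fetch at time `tEnd` exceeded the
capacity `kONL`. -/
def FinishedAt (E : TCPhase T α req) (kONL tEnd : ℕ) : Prop :=
  E.PhaseEnd kONL tEnd ∧ kONL < E.kP tEnd

/-- `size(𝓕)`: the total size of all fields of the phase. -/
noncomputable def sizeFields (E : TCPhase T α req) (tEnd : ℕ) : ℕ :=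
  ∑ t ∈ Finset.Icc 1 tEnd, chgSize (E.chg t)

/-- `req(F^∞)`: the number of requests of the phase lying in slots of the open field
(slots covered by no field of the phase). -/
noncomputable def openReq (E : TCPhase T α req) (tEnd : ℕ) : ℕ :=
  ((Finset.Icc 1 tEnd).filter fun r => ∀ t, t ≤ tEnd → ¬ E.inField t (req r).1 r).card

/-- `TC(P)`: the total cost paid by `TC` during the phase: serving the requests,
fetching/evicting the applied changesets (`α` per node), and the final eviction
(`α · k_P`) if the phase is finished. -/
noncomputable def tcCost (E : TCPhase T α req) (kONL tEnd : ℕ) : ℕ :=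
  ((Finset.Icc 1 tEnd).filter fun r => Costly (req r) (E.cache r)).card
  + α * E.sizeFields tEnd
  + (if kONL < E.kP tEnd then α * E.kP tEnd else 0)

/-- The tree cap `Y` (rooted at `u`, inside the negative field `F^t`) is proper for
the request sequence `ρ`: it holds `req(F^t ∩ Y) = |Y| · α`, and `F^t_{≤ τ} ∩ D` is
not over-requested for every tree cap `D ⊆ Y` rooted at `u` and every time `τ ≤ t`. -/
def Proper (E : TCPhase T α req) (ρ : ℕ → Request V) (t : ℕ) (u : V) (Y : Set V) : Prop :=
  E.fieldReqIn ρ t Y t = Y.ncard * α ∧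
  ∀ (D : Set V) (τ : ℕ), T.TreeCap u D → D ⊆ Y → τ ≤ t →
    E.fieldReqIn ρ t D τ ≤ E.fieldSizeIn t D τ * α

end TCPhase

/-- `D` is a feasible cache schedule for an (offline) algorithm with cache size `k`:
at every time the cache is a subforest of `T` of at most `k` nodes. -/
def IsSchedule {V : Type} (T : RTree V) (k : ℕ) (D : ℕ → Set V) : Prop :=
  ∀ t, T.Subforest (D t) ∧ (D t).ncard ≤ k

/-- The cost of serving the requests of rounds `a, …, b` of `ρ` when the cache during
round `r` is `D r`. -/
noncomputable def serveCost {V : Type} (ρ : ℕ → Request V) (D : ℕ → Set V) (a b : ℕ) : ℕ :=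
  ((Finset.Icc a b).filter fun r => Costly (ρ r) (D r)).card

/-- The reorganization cost of the schedule `D` (`α` per fetched or evicted node) over
the times `a, …, b - 1` (the change at time `t` leads from `D t` to `D (t+1)`). -/
noncomputable def moveCost {V : Type} (α : ℕ) (D : ℕ → Set V) (a b : ℕ) : ℕ :=
  α * ∑ t ∈ Finset.Ico a b, ((D (t + 1) \ D t).ncard + (D t \ D (t + 1)).ncard)

/-- `OPT`: the minimum cost of serving rounds `a, …, b` of `ρ` by an offline algorithm
with cache size `k` that may start with an arbitrary cache. -/
noncomputable def optCostFrom {V : Type} (T : RTree V) (α k : ℕ)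
    (ρ : ℕ → Request V) (a b : ℕ) : ℕ :=
  sInf {n | ∃ D : ℕ → Set V, IsSchedule T k D ∧
    n = serveCost ρ D a b + moveCost α D a b}

/-- `OPT`: the minimum cost of serving rounds `1, …, b` of `ρ` by an offline algorithm
with cache size `k` that starts with the empty cache. -/
noncomputable def optCostEmpty {V : Type} (T : RTree V) (α k : ℕ)
    (ρ : ℕ → Request V) (b : ℕ) : ℕ :=
  sInf {n | ∃ D : ℕ → Set V, IsSchedule T k D ∧ D 0 = ∅ ∧
    n = serveCost ρ D 1 b + moveCost α D 0 b}

/-- `ρ'` is obtained from `ρ` by legally shifting requests: signs are preserved, every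
positive request is moved to a descendant of its node (or kept), and every negative
request is moved to an ancestor of its node (or kept). -/
def LegalShift {V : Type} (T : RTree V) (ρ ρ' : ℕ → Request V) : Prop :=
  ∀ t, (ρ' t).2 = (ρ t).2 ∧
    ((ρ t).2 = true → (ρ' t).1 ∈ T.subtree (ρ t).1) ∧
    ((ρ t).2 = false → (ρ t).1 ∈ T.subtree (ρ' t).1)

/-- A full run of the algorithm `TC` with cache capacity `kONL` on the request
sequence `req`, including phase restarts: whenever the fetch of a saturated changeset
would exceed the capacity, `TC` instead evicts its whole cache and a new phase starts
(`newPhase t` holds, and all counters are reset). -/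
structure TCRun {V : Type} [Fintype V] [DecidableEq V]
    (T : RTree V) (α kONL : ℕ) (req : ℕ → Request V) where
  cache : ℕ → Set V
  cnt : ℕ → V → ℕ
  chg : ℕ → Option (Set V)
  newPhase : ℕ → Prop
  cache_subforest : ∀ t, T.Subforest (cache t)
  cache_zero : cache 0 = ∅
  cnt_zero : ∀ v, cnt 0 v = 0
  capacity : ∀ t, (cache t).ncard ≤ kONL
  cnt_rec : ∀ t v, cnt (t + 1) v =
    (if newPhase t ∨ ∃ X, chg t = some X ∧ v ∈ X then 0 else cnt t v)
    + (if (req (t + 1)).1 = v ∧ Costly (req (t + 1)) (cache (t + 1)) then 1 else 0)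
  step_some : ∀ t X, chg t = some X →
    T.Valid (cache t) X ∧
    X.ncard * α ≤ cntSum (cnt t) X ∧
    (∀ Y, T.Valid (cache t) Y → X ⊂ Y → cntSum (cnt t) Y < Y.ncard * α) ∧
    ((T.ValidPos (cache t) X ∧ (cache t ∪ X).ncard ≤ kONL ∧
        cache (t + 1) = cache t ∪ X ∧ ¬ newPhase t) ∨
     (T.ValidPos (cache t) X ∧ kONL < (cache t ∪ X).ncard ∧
        cache (t + 1) = ∅ ∧ newPhase t) ∨
     (T.ValidNeg (cache t) X ∧ cache (t + 1) = cache t \ X ∧ ¬ newPhase t))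
  step_none : ∀ t, chg t = none →
    cache (t + 1) = cache t ∧ ¬ newPhase t ∧
    ∀ X, T.Valid (cache t) X → cntSum (cnt t) X < X.ncard * α

/-- `TC(I)`: the total cost paid by the run `E` of `TC` on the rounds `1, …, N`:
serving the requests, plus `α` per fetched/evicted node (on a phase restart the whole
cache is evicted). -/
noncomputable def TCRun.cost {V : Type} [Fintype V] [DecidableEq V]
    {T : RTree V} {α kONL : ℕ} {req : ℕ → Request V}
    (E : TCRun T α kONL req) (N : ℕ) : ℕ :=
  ((Finset.Icc 1 N).filter fun r => Costly (req r) (E.cache r)).card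
  + α * ∑ t ∈ Finset.Icc 1 N,
      (if E.newPhase t then (E.cache t).ncard else chgSize (E.chg t))

section CntSum

variable {V : Type} [Fintype V]

theorem cntSum_eq_sum_ite (f : V → ℕ) (A : Set V) :
    cntSum f A = ∑ v : V, if v ∈ A then f v else 0 := by
  simp only [cntSum, Set.indicator_apply]

theorem ncard_eq_cntSum (A : Set V) : A.ncard = cntSum (fun _ => 1) A := by
  rw [cntSum_eq_sum_ite, Finset.sum_boole, Set.ncard_eq_toFinset_card']
  simp only [Nat.cast_id]
  congr 1
  ext v
  simp

theorem cntSum_empty (f : V → ℕ) : cntSum f ∅ = 0 := by simp [cntSum_eq_sum_ite]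

theorem cntSum_union (f : V → ℕ) {A B : Set V} (h : Disjoint A B) :
    cntSum f (A ∪ B) = cntSum f A + cntSum f B := by
  simp only [cntSum_eq_sum_ite, ← Finset.sum_add_distrib]
  refine Finset.sum_congr rfl fun v _ => ?_
  have : v ∈ A → v ∉ B := fun hv => Set.disjoint_left.1 h hv
  by_cases hA : v ∈ A <;> by_cases hB : v ∈ B <;> simp_all

theorem cntSum_mono_set (f : V → ℕ) {A B : Set V} (h : A ⊆ B) : cntSum f A ≤ cntSum f B := by
  simp only [cntSum_eq_sum_ite]
  refine Finset.sum_le_sum fun v _ => ?_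
  have := @h v
  by_cases hA : v ∈ A <;> by_cases hB : v ∈ B <;> simp_all

theorem cntSum_le_cntSum {f g : V → ℕ} {A : Set V} (h : ∀ v ∈ A, f v ≤ g v) :
    cntSum f A ≤ cntSum g A := by
  simp only [cntSum_eq_sum_ite]
  refine Finset.sum_le_sum fun v _ => ?_
  have := h v
  by_cases hA : v ∈ A <;> simp_all

theorem cntSum_congr {f g : V → ℕ} {A : Set V} (h : ∀ v ∈ A, f v = g v) :
    cntSum f A = cntSum g A :=
  le_antisymm (cntSum_le_cntSum fun v hv => (h v hv).le)
    (cntSum_le_cntSum fun v hv => (h v hv).ge)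

theorem cntSum_eq_zero {f : V → ℕ} {A : Set V} (h : ∀ v ∈ A, f v = 0) : cntSum f A = 0 := by
  rw [cntSum_congr h]
  simp [cntSum_eq_sum_ite]

theorem cntSum_add (f g : V → ℕ) (A : Set V) :
    cntSum (fun v => f v + g v) A = cntSum f A + cntSum g A := by
  simp only [cntSum_eq_sum_ite, ← Finset.sum_add_distrib]
  refine Finset.sum_congr rfl fun v _ => ?_
  split_ifs <;> rfl

theorem le_cntSum (f : V → ℕ) {A : Set V} {v : V} (h : v ∈ A) : f v ≤ cntSum f A := by
  rw [cntSum_eq_sum_ite]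
  have := Finset.single_le_sum (f := fun v => if v ∈ A then f v else 0)
    (fun i _ => Nat.zero_le _) (Finset.mem_univ v)
  simpa [h] using this

theorem cntSum_single (u : V) (A : Set V) :
    cntSum (fun v => if u = v then 1 else 0) A = if u ∈ A then 1 else 0 := by
  rw [cntSum_eq_sum_ite, Finset.sum_eq_single u]
  · simp
  · intro b _ hb
    simp [Ne.symm hb]
  · simp

theorem ncard_union_eq {A B : Set V} (h : Disjoint A B) :
    (A ∪ B).ncard = A.ncard + B.ncard := by
  simp only [ncard_eq_cntSum, cntSum_union _ h]

theorem ncard_pos_of_nonempty {A : Set V} (h : A.Nonempty) : 1 ≤ A.ncard := by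
  obtain ⟨v, hv⟩ := h
  rw [ncard_eq_cntSum]
  exact le_cntSum (fun _ => 1) hv

/-- The number of evictions of `v` by the schedule `D` at times `1, …, n - 1`. -/
noncomputable def schedEvict (D : ℕ → Set V) (n : ℕ) (v : V) : ℕ :=
  ∑ t ∈ Finset.Ico 1 n, if v ∈ D t ∧ v ∉ D (t + 1) then 1 else 0

theorem mul_sum_schedEvict_le (α : ℕ) (D : ℕ → Set V) (n : ℕ) :
    α * ∑ v, schedEvict D n v ≤ moveCost α D 1 n := by
  unfold moveCost schedEvict
  rw [Finset.sum_comm]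
  refine Nat.mul_le_mul_left _ (Finset.sum_le_sum fun t _ => ?_)
  refine le_trans (le_of_eq ?_) (Nat.le_add_left _ _)
  simp only [ncard_eq_cntSum, cntSum_eq_sum_ite, Set.mem_sdiff]

end CntSum

namespace RTree

variable {V : Type} {T : RTree V}

theorem mem_subtree_self (v : V) : v ∈ T.subtree v := ⟨0, rfl⟩

theorem subtree_trans {u v w : V} (h₁ : w ∈ T.subtree v) (h₂ : v ∈ T.subtree u) :
    w ∈ T.subtree u := by
  obtain ⟨n, rfl⟩ := h₁
  obtain ⟨m, rfl⟩ := h₂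
  exact ⟨m + n, Function.iterate_add_apply _ _ _ _⟩

theorem iterate_root (n : ℕ) : T.parent^[n] T.root = T.root :=
  Function.iterate_fixed T.parent_root n

theorem subforest_empty : T.Subforest (∅ : Set V) := fun _ h => h.elim

theorem subforest_subtree (v : V) : T.Subforest (T.subtree v) :=
  fun _ hw _ hx => subtree_trans hx hw

theorem Subforest.union {A B : Set V} (hA : T.Subforest A) (hB : T.Subforest B) :
    T.Subforest (A ∪ B) := fun v hv => hv.elim
  (fun h => (hA v h).trans Set.subset_union_left)
  (fun h => (hB v h).trans Set.subset_union_right)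

theorem Subforest.inter {A B : Set V} (hA : T.Subforest A) (hB : T.Subforest B) :
    T.Subforest (A ∩ B) := fun v hv => Set.subset_inter (hA v hv.1) (hB v hv.2)

theorem Subforest.mem_of_parent {A : Set V} (hA : T.Subforest A) {v : V}
    (h : T.parent v ∈ A) : v ∈ A := hA _ h ⟨1, rfl⟩

/-- Removing a set closed under taking parents inside `C` leaves a subforest. -/
theorem Subforest.diff {C Z : Set V} (hC : T.Subforest C)
    (hZ : ∀ w ∈ Z, w ≠ T.root → T.parent w ∈ C → T.parent w ∈ Z) : T.Subforest (C \ Z) := by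
  rintro v hv x ⟨k, hk⟩
  induction k generalizing x with
  | zero =>
    obtain rfl : x = v := hk
    exact hv
  | succ k ih =>
    have hp := ih (x := T.parent x) hk
    refine ⟨hC.mem_of_parent hp.1, fun hx => ?_⟩
    rcases eq_or_ne x T.root with rfl | hr
    · rw [iterate_root] at hk
      exact hv.2 (hk ▸ hx)
    · exact hp.2 (hZ x hx hr hp.1)

theorem card_ancestors_le_height [Fintype V] [DecidableEq V] (T : RTree V) (w : V) :
    (∑ v : V, if w ∈ T.subtree v then 1 else 0) ≤ T.height := by
  rw [Finset.sum_boole, Nat.cast_id]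
  have hd : T.parent^[T.depth w] w = T.root := Nat.find_spec (T.reaches_root w)
  have hsub : (Finset.univ.filter fun v => w ∈ T.subtree v) ⊆
      (Finset.range (T.depth w + 1)).image fun n => T.parent^[n] w := by
    intro v hv
    obtain ⟨n, hn⟩ := (Finset.mem_filter.1 hv).2
    rw [Finset.mem_image]
    rcases le_total n (T.depth w) with h | h
    · exact ⟨n, Finset.mem_range.2 (by omega), hn⟩
    · refine ⟨T.depth w, Finset.mem_range.2 (by omega), ?_⟩
      obtain ⟨m, rfl⟩ := Nat.exists_eq_add_of_le' h
      rw [← hn, Function.iterate_add_apply, hd, iterate_root]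
  calc _ ≤ _ := Finset.card_le_card hsub
    _ ≤ T.depth w + 1 := Finset.card_image_le.trans (Finset.card_range _).le
    _ ≤ T.height := Nat.succ_le_succ (Finset.le_sup (f := fun v => T.depth v) (Finset.mem_univ w))

end RTree

namespace TCPhase

variable {V : Type} [Fintype V] [DecidableEq V]
  {T : RTree V} {α : ℕ} {req : ℕ → Request V}

/-- The set of nodes fetched or evicted at time `t`. -/
def changed (E : TCPhase T α req) (t : ℕ) : Set V :=
  {v | ∃ X, E.chg t = some X ∧ v ∈ X}

theorem changed_of_some (E : TCPhase T α req) {t : ℕ} {X : Set V} (h : E.chg t = some X) :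
    E.changed t = X := by
  ext v
  simp [changed, h]

theorem changed_of_none (E : TCPhase T α req) {t : ℕ} (h : E.chg t = none) :
    E.changed t = ∅ := by
  ext v
  simp [changed, h]

theorem cache_succ_of_some (E : TCPhase T α req) {t : ℕ} {X : Set V} (h : E.chg t = some X) :
    (T.ValidPos (E.cache t) X ∧ E.cache (t + 1) = E.cache t ∪ X) ∨
    (T.ValidNeg (E.cache t) X ∧ E.cache (t + 1) = E.cache t \ X) := by
  obtain ⟨hv, -, -, hc⟩ := E.step_some t X h
  by_cases hp : T.ValidPos (E.cache t) X
  · rw [if_pos hp] at hc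
    exact Or.inl ⟨hp, hc⟩
  · rw [if_neg hp] at hc
    exact Or.inr ⟨hv.resolve_left hp, hc⟩

theorem mem_changed_iff (E : TCPhase T α req) (t : ℕ) (v : V) :
    v ∈ E.changed t ↔ ¬ (v ∈ E.cache t ↔ v ∈ E.cache (t + 1)) := by
  rcases h : E.chg t with _ | X
  · rw [E.changed_of_none h, (E.step_none t h).1]
    simp
  · rw [E.changed_of_some h]
    rcases E.cache_succ_of_some h with ⟨⟨-, hd, -⟩, hc⟩ | ⟨⟨-, hs, -⟩, hc⟩
    · have : v ∈ X → v ∉ E.cache t := fun h1 h2 => by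
        have : v ∈ X ∩ E.cache t := ⟨h1, h2⟩
        simp [hd] at this
      rw [hc, Set.mem_union]
      tauto
    · have := @hs v
      rw [hc, Set.mem_sdiff]
      tauto

theorem cnt_succ (E : TCPhase T α req) (t : ℕ) (v : V) :
    E.cnt (t + 1) v = (if v ∈ E.changed t then 0 else E.cnt t v) +
      (if (req (t + 1)).1 = v ∧ Costly (req (t + 1)) (E.cache (t + 1)) then 1 else 0) := by
  convert E.cnt_rec t v
  rfl

/-- Right after the cache change at time `t` no valid changeset is saturated, provided that
right before it the only saturated changesets were those containing the last request. -/
theorem cntSum_post_lt (E : TCPhase T α req) (hα : 1 ≤ α) {n : ℕ}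
    (ih : ∀ Y, T.Valid (E.cache n) Y →
      cntSum (E.cnt n) Y < Y.ncard * α + (if (req n).1 ∈ Y then 1 else 0))
    {Y : Set V} (hY : T.Valid (E.cache (n + 1)) Y) :
    cntSum (fun v => if v ∈ E.changed n then 0 else E.cnt n v) Y < Y.ncard * α := by
  have hYpos : 1 ≤ Y.ncard := ncard_pos_of_nonempty (hY.elim (·.1) (·.1))
  rcases h : E.chg n with _ | X
  · obtain ⟨hc, hs⟩ := E.step_none n h
    rw [hc] at hY
    simpa [E.changed_of_none h] using hs Y hY
  obtain ⟨hXv, hXsat, hXmax, -⟩ := E.step_some n X h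
  rw [E.changed_of_some h]
  have hout : ∀ A : Set V, Disjoint A X →
      cntSum (fun v => if v ∈ X then 0 else E.cnt n v) A = cntSum (E.cnt n) A := fun A hA =>
    cntSum_congr fun v hv => if_neg (Set.disjoint_left.1 hA hv)
  have hsplit : cntSum (fun v => if v ∈ X then 0 else E.cnt n v) Y = cntSum (E.cnt n) (Y \ X) := by
    rw [← Set.sdiff_union_inter Y X,
      cntSum_union _ (Set.disjoint_sdiff_left.mono_right Set.inter_subset_right),
      cntSum_eq_zero (A := Y ∩ X) (fun v hv => if_pos hv.2), hout _ Set.disjoint_sdiff_left,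
      Set.sdiff_union_inter]
    rfl
  have hreq : (req n).1 ∈ X := by
    by_contra hn
    have := ih X hXv
    rw [if_neg hn] at this
    omega
  have hcup : ∀ (_ : Disjoint X Y) (_ : T.Valid (E.cache n) (X ∪ Y)),
      cntSum (fun v => if v ∈ X then 0 else E.cnt n v) Y < Y.ncard * α := by
    intro hd hv
    have hss : X ⊂ X ∪ Y := by
      refine ⟨Set.subset_union_left, fun hsub => ?_⟩
      obtain ⟨y, hy⟩ : Y.Nonempty := hY.elim (·.1) (·.1)
      exact Set.disjoint_right.1 hd hy (hsub (Or.inr hy))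
    have := hXmax _ hv hss
    rw [cntSum_union _ hd, ncard_union_eq hd, add_mul] at this
    rw [hout _ hd.symm]
    omega
  have hdiff : ∀ (_ : (Y \ X).Nonempty → T.Valid (E.cache n) (Y \ X)),
      cntSum (fun v => if v ∈ X then 0 else E.cnt n v) Y < Y.ncard * α := by
    intro hv
    rw [hsplit]
    have hle : (Y \ X).ncard * α ≤ Y.ncard * α := by
      gcongr
      · exact Set.toFinite _
      · exact Set.sdiff_subset
    rcases (Y \ X).eq_empty_or_nonempty with h0 | hne
    · rw [h0, cntSum_empty]
      positivity
    · have := ih _ (hv hne)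
      rw [if_neg (fun hm => hm.2 hreq)] at this
      omega
  rcases E.cache_succ_of_some h with ⟨⟨hne, hd, hsub⟩, hc⟩ | ⟨⟨hne, hs, hsub⟩, hc⟩
  · have hd' : ∀ v ∈ X, v ∉ E.cache n := fun v h1 h2 => by
      have : v ∈ X ∩ E.cache n := ⟨h1, h2⟩
      simp [hd] at this
    rw [hc] at hY
    rcases hY with ⟨-, hYd, hYs⟩ | ⟨-, hYs, hYf⟩
    · have hYd' : ∀ v ∈ Y, v ∉ E.cache n ∪ X := fun v h1 h2 => by
        have : v ∈ Y ∩ (E.cache n ∪ X) := ⟨h1, h2⟩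
        simp [hYd] at this
      refine hcup (Set.disjoint_right.2 fun v hv hx => hYd' v hv (Or.inr hx)) (Or.inl ⟨?_, ?_, ?_⟩)
      · exact hne.mono Set.subset_union_left
      · ext v
        have := hd' v
        have := hYd' v
        simp only [Set.mem_inter_iff, Set.mem_union, Set.mem_empty_iff_false] at *
        tauto
      · rwa [← Set.union_assoc]
    · refine hdiff fun hne' => Or.inr ⟨hne', ?_, ?_⟩
      · intro v hv
        exact (hYs hv.1).resolve_right hv.2
      · have : E.cache n \ (Y \ X) = E.cache n ∩ ((E.cache n ∪ X) \ Y) := by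
          ext v
          have := hd' v
          simp only [Set.mem_inter_iff, Set.mem_union, Set.mem_sdiff]
          tauto
        rw [this]
        exact (E.cache_subforest n).inter hYf
  · rw [hc] at hY
    rcases hY with ⟨-, hYd, hYs⟩ | ⟨-, hYs, hYf⟩
    · have hYd' : ∀ v ∈ Y, v ∉ E.cache n \ X := fun v h1 h2 => by
        have : v ∈ Y ∩ (E.cache n \ X) := ⟨h1, h2⟩
        simp [hYd] at this
      refine hdiff fun hne' => Or.inl ⟨hne', ?_, ?_⟩
      · ext v
        have := hYd' v
        simp only [Set.mem_inter_iff, Set.mem_sdiff, Set.mem_empty_iff_false] at *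
        tauto
      · have : E.cache n ∪ (Y \ X) = E.cache n ∪ ((E.cache n \ X) ∪ Y) := by
          ext v
          have := @hs v
          simp only [Set.mem_union, Set.mem_sdiff]
          tauto
        rw [this]
        exact (E.cache_subforest n).union hYs
    · refine hcup (Set.disjoint_right.2 fun v hv hx => (hYs hv).2 hx) (Or.inr ⟨?_, ?_, ?_⟩)
      · exact hne.mono Set.subset_union_left
      · exact Set.union_subset hs fun v hv => (hYs hv).1
      · rwa [← Set.sdiff_sdiff]

theorem cntSum_lt (E : TCPhase T α req) (hα : 1 ≤ α) (n : ℕ) (Y : Set V)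
    (hY : T.Valid (E.cache n) Y) :
    cntSum (E.cnt n) Y < Y.ncard * α + (if (req n).1 ∈ Y then 1 else 0) := by
  induction n generalizing Y with
  | zero =>
    rw [cntSum_eq_zero fun v _ => E.cnt_zero v]
    have : 1 ≤ Y.ncard := ncard_pos_of_nonempty (hY.elim (·.1) (·.1))
    positivity
  | succ n ih =>
    have hpost := E.cntSum_post_lt hα ih hY
    have hle : cntSum (E.cnt (n + 1)) Y ≤
        cntSum (fun v => if v ∈ E.changed n then 0 else E.cnt n v) Y +
          (if (req (n + 1)).1 ∈ Y then 1 else 0) := by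
      rw [← cntSum_single, ← cntSum_add]
      refine cntSum_le_cntSum fun v _ => ?_
      rw [E.cnt_succ]
      by_cases h : (req (n + 1)).1 = v
      · simp only [h, true_and, if_true]
        split_ifs <;> omega
      · simp [h]
    omega

/-- No valid changeset is ever over-saturated. -/
theorem cntSum_le (E : TCPhase T α req) (hα : 1 ≤ α) {n : ℕ} {Y : Set V}
    (hY : T.Valid (E.cache n) Y) : cntSum (E.cnt n) Y ≤ Y.ncard * α := by
  have := E.cntSum_lt hα n Y hY
  split_ifs at this <;> omega

theorem chg_zero (E : TCPhase T α req) (hα : 1 ≤ α) : E.chg 0 = none := by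
  rcases h : E.chg 0 with _ | X
  · rfl
  · obtain ⟨hv, hs, -⟩ := E.step_some 0 X h
    have : 1 ≤ X.ncard := ncard_pos_of_nonempty (hv.elim (·.1) (·.1))
    rw [cntSum_eq_zero fun v _ => E.cnt_zero v] at hs
    nlinarith

/-- The number of requests at `v` since its last state change in rounds satisfying `p`. -/
noncomputable def acc (E : TCPhase T α req) (p : ℕ → Prop) : ℕ → V → ℕ
  | 0, _ => 0
  | n + 1, v => (if v ∈ E.changed n then 0 else acc E p n v) +
      (if (req (n + 1)).1 = v ∧ p (n + 1) then 1 else 0)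

/-- The nodes that the schedule `D` held in its cache at some round since their last state
change. -/
def touched (E : TCPhase T α req) (D : ℕ → Set V) : ℕ → Set V
  | 0 => ∅
  | n + 1 => D (n + 1) ∪ (touched E D n \ E.changed n)

/-- The nodes that the schedule `D` held in its cache at all rounds since their last state
change. -/
def kept (E : TCPhase T α req) (D : ℕ → Set V) : ℕ → Set V
  | 0 => Set.univ
  | n + 1 => D (n + 1) ∩ (kept E D n ∪ E.changed n)

/-- The sum of `f t v` over the times `t < n` at which `v` is fetched. -/
noncomputable def fetchSum (E : TCPhase T α req) (f : ℕ → V → ℕ) (n : ℕ) (v : V) : ℕ :=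
  ∑ t ∈ Finset.range n, if v ∉ E.cache t ∧ v ∈ E.cache (t + 1) then f t v else 0

/-- The sum of `f t v` over the times `t < n` at which `v` is evicted. -/
noncomputable def evictSum (E : TCPhase T α req) (f : ℕ → V → ℕ) (n : ℕ) (v : V) : ℕ :=
  ∑ t ∈ Finset.range n, if v ∈ E.cache t ∧ v ∉ E.cache (t + 1) then f t v else 0

/-- The indicator of a time-dependent set of nodes. -/
noncomputable def flag (S : ℕ → Set V) (t : ℕ) (v : V) : ℕ := if v ∈ S t then 1 else 0

/-- The schedule `D` pays for the request of round `r`. -/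
def PaidBy (req : ℕ → Request V) (D : ℕ → Set V) (r : ℕ) : Prop := Costly (req r) (D r)

theorem fetchSum_succ (E : TCPhase T α req) (f : ℕ → V → ℕ) (n : ℕ) (v : V) :
    E.fetchSum f (n + 1) v = E.fetchSum f n v +
      if v ∉ E.cache n ∧ v ∈ E.cache (n + 1) then f n v else 0 :=
  Finset.sum_range_succ _ _

theorem evictSum_succ (E : TCPhase T α req) (f : ℕ → V → ℕ) (n : ℕ) (v : V) :
    E.evictSum f (n + 1) v = E.evictSum f n v +
      if v ∈ E.cache n ∧ v ∉ E.cache (n + 1) then f n v else 0 :=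
  Finset.sum_range_succ _ _

theorem costly_cache (E : TCPhase T α req) (hgood : E.GoodReq) (n : ℕ) :
    Costly (req (n + 1)) (E.cache (n + 1)) := by
  obtain ⟨h1, h2⟩ := hgood (n + 1) (by omega)
  rcases h : (req (n + 1)).2 with _ | _
  · exact Or.inr ⟨h, h2 h⟩
  · exact Or.inl ⟨h, h1 h⟩

theorem cnt_eq_acc_add_acc (E : TCPhase T α req) (hgood : E.GoodReq) (p : ℕ → Prop)
    (n : ℕ) (v : V) : E.cnt n v = E.acc p n v + E.acc (fun r => ¬ p r) n v := by
  induction n with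
  | zero => simp [acc, E.cnt_zero]
  | succ n ih =>
    have := E.costly_cache hgood n
    rw [E.cnt_succ, ih, acc, acc]
    by_cases h : p (n + 1) <;> by_cases h' : v ∈ E.changed n <;> simp [*] <;> omega

theorem fetchSum_add_evictSum_acc_le (E : TCPhase T α req) (p : ℕ → Prop) (n : ℕ) (v : V) :
    E.fetchSum (E.acc p) n v + E.evictSum (E.acc p) n v + E.acc p n v ≤
      ∑ t ∈ Finset.Icc 1 n, if (req t).1 = v ∧ p t then 1 else 0 := by
  induction n with
  | zero => simp [fetchSum, evictSum, acc]
  | succ n ih =>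
    rw [Finset.sum_Icc_succ_top (by omega), fetchSum_succ, evictSum_succ, acc]
    have := E.mem_changed_iff n v
    by_cases h1 : v ∈ E.cache n <;> by_cases h2 : v ∈ E.cache (n + 1) <;>
      simp only [h1, h2, this, not_true_eq_false, not_false_eq_true, and_self, and_false, and_true,
        if_true, if_false, iff_true, iff_false] <;> omega

/-- The requests of a node `v` outside the cache of `TC` for which `D` does not pay are charged
to the descendants of `v` that `D` holds during one of their own non-cached periods. -/
theorem fetchSum_unpaid_le (E : TCPhase T α req) (hα : 1 ≤ α) (hgood : E.GoodReq)
    {D : ℕ → Set V} (hD : ∀ t, T.Subforest (D t)) (v : V) (n : ℕ) :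
    E.fetchSum (E.acc fun r => ¬ PaidBy req D r) n v ≤
        α * cntSum (E.fetchSum (flag (E.touched D)) n) (T.subtree v) ∧
      (v ∉ E.cache n → E.fetchSum (E.acc fun r => ¬ PaidBy req D r) n v +
          E.acc (fun r => ¬ PaidBy req D r) n v ≤
        α * cntSum (fun w => E.fetchSum (flag (E.touched D)) n w +
          if w ∉ E.cache n ∧ w ∈ E.touched D n then 1 else 0) (T.subtree v)) := by
  induction n with
  | zero => simp [fetchSum, acc]
  | succ n ih =>
    obtain ⟨ih1, ih2⟩ := ih
    have hmono : E.fetchSum (E.acc fun r => ¬ PaidBy req D r) (n + 1) v ≤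
        α * cntSum (E.fetchSum (flag (E.touched D)) (n + 1)) (T.subtree v) := by
      rw [fetchSum_succ]
      split_ifs with h
      · refine (ih2 h.1).trans (Nat.mul_le_mul_left _ (cntSum_le_cntSum fun w hw => ?_))
        have hw' : w ∈ E.cache (n + 1) := E.cache_subforest _ v h.2 hw
        rw [fetchSum_succ]
        by_cases hwc : w ∈ E.cache n <;> simp [hwc, hw', flag]
      · refine ih1.trans (Nat.mul_le_mul_left _ (cntSum_le_cntSum fun w _ => ?_))
        rw [fetchSum_succ]
        omega
    refine ⟨hmono, fun hv => ?_⟩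
    by_cases hreq : (req (n + 1)).1 = v ∧ ¬ PaidBy req D (n + 1)
    · obtain ⟨rfl, hnp⟩ := hreq
      set v := (req (n + 1)).1 with hvdef
      have hvD : v ∈ D (n + 1) := by
        rcases h : (req (n + 1)).2 with _ | _
        · exact absurd ((hgood (n + 1) (by omega)).2 h) hv
        · by_contra hvD
          exact hnp (Or.inl ⟨h, hvD⟩)
      have htouch : ∀ w ∈ T.subtree v, w ∈ E.touched D (n + 1) := fun w hw =>
        Or.inl (hD _ v hvD hw)
      have hval : T.ValidPos (E.cache (n + 1)) (T.subtree v \ E.cache (n + 1)) := by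
        refine ⟨⟨v, T.mem_subtree_self v, hv⟩, by simp, ?_⟩
        rw [Set.union_sdiff_self]
        exact (E.cache_subforest _).union (T.subforest_subtree v)
      have hacc : E.acc (fun r => ¬ PaidBy req D r) (n + 1) v ≤
          (T.subtree v \ E.cache (n + 1)).ncard * α := by
        refine le_trans ?_ (E.cntSum_le hα (Or.inl hval))
        refine le_trans ?_ (le_cntSum (E.cnt (n + 1)) (v := v) ⟨T.mem_subtree_self v, hv⟩)
        rw [E.cnt_eq_acc_add_acc hgood (PaidBy req D)]
        omega
      have hcard : (T.subtree v \ E.cache (n + 1)).ncard ≤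
          cntSum (fun w => if w ∉ E.cache (n + 1) ∧ w ∈ E.touched D (n + 1) then 1 else 0)
            (T.subtree v) := by
        rw [ncard_eq_cntSum]
        refine le_trans (le_of_eq (cntSum_congr fun w hw => ?_))
          (cntSum_mono_set _ Set.sdiff_subset)
        rw [if_pos ⟨hw.2, htouch w hw.1⟩]
      rw [cntSum_add, mul_add]
      refine add_le_add hmono (hacc.trans ?_)
      rw [mul_comm]
      exact Nat.mul_le_mul_left _ hcard
    · rw [acc, if_neg hreq, add_zero]
      by_cases hch : v ∈ E.changed n
      · rw [if_pos hch, add_zero]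
        exact hmono.trans (Nat.mul_le_mul_left _ (cntSum_le_cntSum fun w _ => by omega))
      · rw [if_neg hch, fetchSum_succ, if_neg (fun h => hv h.2), add_zero]
        have hvn : v ∉ E.cache n := by
          rw [E.mem_changed_iff] at hch
          tauto
        refine (ih2 hvn).trans (Nat.mul_le_mul_left _ (cntSum_le_cntSum fun w _ => ?_))
        rw [fetchSum_succ, add_assoc]
        gcongr
        by_cases hw : w ∉ E.cache n ∧ w ∈ E.touched D n
        · by_cases hw' : w ∈ E.cache (n + 1)
          · simp [hw, hw', flag]
          · have : w ∉ E.changed n := by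
              rw [E.mem_changed_iff]
              tauto
            have : w ∈ E.touched D (n + 1) := Or.inr ⟨hw.2, this⟩
            simp [hw, hw', this]
        · simp [hw]

theorem kept_succ_subset (E : TCPhase T α req) (D : ℕ → Set V) (n : ℕ) :
    E.kept D (n + 1) ⊆ D (n + 1) := Set.inter_subset_left

theorem fetchSum_touched_invariant (E : TCPhase T α req) (hα : 1 ≤ α) (D : ℕ → Set V) (v : V)
    (n : ℕ) :
    (v ∈ E.cache (n + 1) → E.fetchSum (flag (E.touched D)) (n + 1) v ≤
      E.evictSum (flag (E.kept D)) (n + 1) v + schedEvict D (n + 1) v +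
        flag (E.kept D) (n + 1) v) ∧
    (v ∉ E.cache (n + 1) → E.fetchSum (flag (E.touched D)) (n + 1) v +
        (if v ∈ E.touched D (n + 1) ∧ v ∉ D (n + 1) then 1 else 0) ≤
      E.evictSum (flag (E.kept D)) (n + 1) v + schedEvict D (n + 1) v) := by
  induction n with
  | zero =>
    have h1 : E.cache 1 = ∅ := by
      rw [(E.step_none 0 (E.chg_zero hα)).1, E.cache_zero]
    simp [fetchSum, h1, touched]
  | succ n ih =>
    have hs : schedEvict D (n + 1 + 1) v = schedEvict D (n + 1) v +
        if v ∈ D (n + 1) ∧ v ∉ D (n + 1 + 1) then 1 else 0 :=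
      Finset.sum_Ico_succ_top (by omega) _
    have hch := E.mem_changed_iff (n + 1) v
    have hk : v ∈ E.kept D (n + 1 + 1) ↔
      v ∈ D (n + 1 + 1) ∧ (v ∈ E.kept D (n + 1) ∨ v ∈ E.changed (n + 1)) := Iff.rfl
    have ht : v ∈ E.touched D (n + 1 + 1) ↔
      v ∈ D (n + 1 + 1) ∨ (v ∈ E.touched D (n + 1) ∧ v ∉ E.changed (n + 1)) := Iff.rfl
    have hkD : v ∈ E.kept D (n + 1) → v ∈ D (n + 1) := fun h => E.kept_succ_subset D n h
    have htD : v ∈ D (n + 1) → v ∈ E.touched D (n + 1) := Or.inl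
    rw [E.fetchSum_succ _ (n + 1), E.evictSum_succ _ (n + 1), hs]
    simp only [flag] at *
    by_cases c1 : v ∈ E.cache (n + 1) <;> by_cases c2 : v ∈ E.cache (n + 1 + 1) <;>
      by_cases d1 : v ∈ D (n + 1) <;> by_cases d2 : v ∈ D (n + 1 + 1) <;>
      by_cases k : v ∈ E.kept D (n + 1) <;> by_cases t : v ∈ E.touched D (n + 1) <;>
      simp_all <;> omega

/-- Every non-cached period of `v` during which `D` held `v` is unfinished, or is followed by a
cached period during which `D` always held `v`, or by an eviction of `v` by `D`. -/
theorem fetchSum_touched_le (E : TCPhase T α req) (hα : 1 ≤ α) (D : ℕ → Set V) (v : V) (n : ℕ) :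
    E.fetchSum (flag (E.touched D)) (n + 1) v ≤
      E.evictSum (flag (E.kept D)) (n + 1) v + schedEvict D n v +
        (if v ∈ E.cache (n + 1) then 1 else 0) := by
  rcases n with _ | n
  · simp [fetchSum, (E.step_none 0 (E.chg_zero hα)).1, E.cache_zero]
  · obtain ⟨h1, h2⟩ := E.fetchSum_touched_invariant hα D v n
    have htD : v ∈ D (n + 1) → v ∈ E.touched D (n + 1) := Or.inl
    rw [E.fetchSum_succ _ (n + 1), E.evictSum_succ _ (n + 1)]
    simp only [flag] at *
    by_cases c1 : v ∈ E.cache (n + 1) <;> by_cases c2 : v ∈ E.cache (n + 1 + 1) <;>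
      by_cases k : v ∈ E.kept D (n + 1) <;> by_cases t : v ∈ E.touched D (n + 1) <;>
      simp_all <;> omega

/-- A bound on the unpaid requests in every part of the cache whose top nodes are all kept by `D`
extends to every part of the cache whose top nodes are kept by `D` or are roots of components. -/
theorem unpaid_le_of_unpaid_le_kept (E : TCPhase T α req) (hα : 1 ≤ α) (hgood : E.GoodReq)
    {D : ℕ → Set V} {n : ℕ}
    (hJ : ∀ Z ⊆ E.cache n, (∀ w ∈ Z, w ∈ E.kept D n ∨ (w ≠ T.root ∧ T.parent w ∈ Z)) →
      cntSum (E.acc (fun r => ¬ PaidBy req D r) n) Z ≤ α * (Z \ E.kept D n).ncard)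
    {Z : Set V} (hZ : Z ⊆ E.cache n)
    (hZp : ∀ w ∈ Z, w ∈ E.kept D n ∨ (w ≠ T.root → T.parent w ∈ E.cache n → T.parent w ∈ Z)) :
    cntSum (E.acc (fun r => ¬ PaidBy req D r) n) Z ≤ α * (Z \ E.kept D n).ncard := by
  let P : Set V → Prop := fun S =>
    S ⊆ Z ∧ ∀ w ∈ S, w ∈ E.kept D n ∨ (w ≠ T.root ∧ T.parent w ∈ S)
  let Z₁ : Set V := {w | ∃ S, P S ∧ w ∈ S}
  have hZ₁ : P Z₁ := by
    refine ⟨fun w ⟨S, hS, hw⟩ => hS.1 hw, fun w ⟨S, hS, hw⟩ => ?_⟩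
    exact (hS.2 w hw).imp id fun h => ⟨h.1, S, hS, h.2⟩
  have hins : ∀ w ∈ Z, (w ∈ E.kept D n ∨ (w ≠ T.root ∧ T.parent w ∈ Z₁)) → w ∈ Z₁ := by
    intro w hw h
    refine ⟨insert w Z₁, ⟨Set.insert_subset hw hZ₁.1, ?_⟩, Set.mem_insert _ _⟩
    rintro x (rfl | hx)
    · exact h.imp id fun h => ⟨h.1, Or.inr h.2⟩
    · exact (hZ₁.2 x hx).imp id fun h => ⟨h.1, Or.inr h.2⟩
  have hunk : ∀ w ∈ Z \ Z₁, w ∉ E.kept D n := fun w hw h => hw.2 (hins w hw.1 (Or.inl h))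
  have h₁ := hJ Z₁ (hZ₁.1.trans hZ) hZ₁.2
  have h₀ : cntSum (E.acc (fun r => ¬ PaidBy req D r) n) (Z \ Z₁) ≤ α * (Z \ Z₁).ncard := by
    rcases (Z \ Z₁).eq_empty_or_nonempty with h | hne
    · simp [h, cntSum_empty]
    · have hval : T.ValidNeg (E.cache n) (Z \ Z₁) := by
        refine ⟨hne, Set.sdiff_subset.trans hZ, (E.cache_subforest n).diff fun w hw hr hc => ?_⟩
        refine ⟨(hZp w hw.1).resolve_left (hunk w hw) hr hc, fun h => ?_⟩
        exact hw.2 (hins w hw.1 (Or.inr ⟨hr, h⟩))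
      rw [mul_comm]
      refine le_trans (cntSum_le_cntSum fun w _ => ?_) (E.cntSum_le hα (Or.inr hval))
      rw [E.cnt_eq_acc_add_acc hgood (PaidBy req D)]
      omega
  have hZeq : Z = (Z \ Z₁) ∪ Z₁ := (Set.sdiff_union_of_subset hZ₁.1).symm
  have hKeq : Z \ E.kept D n = (Z \ Z₁) ∪ (Z₁ \ E.kept D n) := by
    ext w
    have := hunk w
    have := @hZ₁.1 w
    simp only [Set.mem_sdiff, Set.mem_union] at *
    tauto
  rw [hKeq, ncard_union_eq (Set.disjoint_sdiff_left.mono_right Set.sdiff_subset), mul_add]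
  conv_lhs => rw [hZeq]
  rw [cntSum_union _ Set.disjoint_sdiff_left]
  exact add_le_add h₀ h₁

theorem unpaid_le_of_top_kept (E : TCPhase T α req) (hα : 1 ≤ α) (hgood : E.GoodReq)
    {D : ℕ → Set V} (hD : ∀ t, T.Subforest (D t)) (n : ℕ) :
    ∀ Z ⊆ E.cache n, (∀ w ∈ Z, w ∈ E.kept D n ∨ (w ≠ T.root ∧ T.parent w ∈ Z)) →
      cntSum (E.acc (fun r => ¬ PaidBy req D r) n) Z ≤ α * (Z \ E.kept D n).ncard := by
  induction n with
  | zero =>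
    intro Z _ _
    rw [cntSum_eq_zero (f := E.acc _ 0) fun _ _ => rfl]
    exact Nat.zero_le _
  | succ n ih =>
    intro Z hZ hZp
    have hZD : ∀ w ∈ Z, w ∈ D (n + 1) := by
      intro w hw
      obtain ⟨k, hk⟩ := T.reaches_root w
      induction k generalizing w with
      | zero =>
        obtain rfl : w = T.root := hk
        exact ((hZp _ hw).resolve_right fun h => h.1 rfl).1
      | succ k ihk =>
        rcases hZp w hw with h | h
        · exact h.1
        · exact (hD _).mem_of_parent (ihk _ h.2 hk)
    have hacc : ∀ w ∈ Z, E.acc (fun r => ¬ PaidBy req D r) (n + 1) w =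
        if w ∈ E.changed n then 0 else E.acc (fun r => ¬ PaidBy req D r) n w := by
      intro w hw
      have hpaid : ¬ ((req (n + 1)).1 = w ∧ ¬ PaidBy req D (n + 1)) := by
        rintro ⟨rfl, hp⟩
        rcases h : (req (n + 1)).2 with _ | _
        · exact hp (Or.inr ⟨h, hZD _ hw⟩)
        · exact (hgood (n + 1) (by omega)).1 h (hZ hw)
      rw [acc, if_neg hpaid, add_zero]
    have hchg : ∀ w ∈ E.cache (n + 1), w ∈ E.changed n ↔ w ∉ E.cache n := fun w hw => by
      rw [E.mem_changed_iff]
      tauto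
    have hkept : ∀ w ∈ Z ∩ E.cache n, w ∈ E.kept D (n + 1) → w ∈ E.kept D n := by
      intro w hw h
      refine h.2.resolve_right fun hc => ?_
      exact (hchg w (hZ hw.1)).1 hc hw.2
    have hle := E.unpaid_le_of_unpaid_le_kept hα hgood ih (Z := Z ∩ E.cache n)
      Set.inter_subset_right fun w hw => by
        rcases hZp w hw.1 with h | h
        · exact Or.inl (hkept w hw h)
        · exact Or.inr fun _ hc => ⟨h.2, hc⟩
    have hsum : cntSum (E.acc (fun r => ¬ PaidBy req D r) (n + 1)) Z =
        cntSum (E.acc (fun r => ¬ PaidBy req D r) n) (Z ∩ E.cache n) := by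
      conv_lhs => rw [← Set.sdiff_union_inter Z (E.cache n)]
      rw [cntSum_union _ (Set.disjoint_sdiff_left.mono_right Set.inter_subset_right),
        cntSum_eq_zero fun w hw => ?_, zero_add]
      · refine cntSum_congr fun w hw => ?_
        rw [hacc w hw.1, if_neg fun h => (hchg w (hZ hw.1)).1 h hw.2]
      · rw [hacc w hw.1, if_pos ((hchg w (hZ hw.1)).2 hw.2)]
    rw [hsum]
    refine hle.trans (Nat.mul_le_mul_left _ (Set.ncard_le_ncard ?_ (Set.toFinite _)))
    exact fun w hw => ⟨hw.1.1, fun h => hw.2 (hkept w hw.1 h)⟩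

/-- For an evicted changeset, `D` pays at least `α` for every node it kept throughout. -/
theorem kept_mul_le_paid (E : TCPhase T α req) (hα : 1 ≤ α) (hgood : E.GoodReq)
    {D : ℕ → Set V} (hD : ∀ t, T.Subforest (D t)) {t : ℕ} {X : Set V} (h : E.chg t = some X)
    (hX : T.ValidNeg (E.cache t) X) :
    α * (X ∩ E.kept D t).ncard ≤ cntSum (E.acc (PaidBy req D) t) X := by
  have hun := E.unpaid_le_of_unpaid_le_kept hα hgood (E.unpaid_le_of_top_kept hα hgood hD t)
    hX.2.1 fun w hw => Or.inr fun _ hc => by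
      by_contra hp
      exact (hX.2.2.mem_of_parent ⟨hc, hp⟩).2 hw
  have hsat := (E.step_some t X h).2.1
  rw [cntSum_congr fun v _ => E.cnt_eq_acc_add_acc hgood (PaidBy req D) t v, cntSum_add] at hsat
  have hcard : X.ncard = (X \ E.kept D t).ncard + (X ∩ E.kept D t).ncard := by
    rw [← ncard_union_eq (Set.disjoint_sdiff_left.mono_right Set.inter_subset_right),
      Set.sdiff_union_inter]
  rw [hcard, mul_comm, mul_add] at hsat
  omega

theorem chg_cases (E : TCPhase T α req) (t : ℕ) :
    (E.chg t = none ∧ E.cache (t + 1) \ E.cache t = ∅ ∧ E.cache t \ E.cache (t + 1) = ∅) ∨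
    ∃ X, E.chg t = some X ∧
      ((T.ValidPos (E.cache t) X ∧ E.cache (t + 1) \ E.cache t = X ∧
          E.cache t \ E.cache (t + 1) = ∅) ∨
        (T.ValidNeg (E.cache t) X ∧ E.cache (t + 1) \ E.cache t = ∅ ∧
          E.cache t \ E.cache (t + 1) = X)) := by
  rcases h : E.chg t with _ | X
  · simp [(E.step_none t h).1]
  · refine Or.inr ⟨X, rfl, ?_⟩
    rcases E.cache_succ_of_some h with ⟨hv, hc⟩ | ⟨hv, hc⟩
    · refine Or.inl ⟨hv, ?_, ?_⟩
      · rw [hc, Set.union_sdiff_left, sdiff_eq_left, Set.disjoint_iff_inter_eq_empty]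
        exact hv.2.1
      · rw [hc, Set.sdiff_eq_empty]
        exact Set.subset_union_left
    · refine Or.inr ⟨hv, ?_, ?_⟩
      · rw [hc, Set.sdiff_eq_empty]
        exact Set.sdiff_subset
      · rw [hc, Set.sdiff_sdiff_cancel_left hv.2.1]

theorem sum_fetchSum (E : TCPhase T α req) (f : ℕ → V → ℕ) (n : ℕ) :
    ∑ v, E.fetchSum f n v =
      ∑ t ∈ Finset.range n, cntSum (f t) (E.cache (t + 1) \ E.cache t) := by
  simp only [fetchSum, cntSum_eq_sum_ite, Set.mem_sdiff]
  rw [Finset.sum_comm]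
  simp only [and_comm]

theorem sum_evictSum (E : TCPhase T α req) (f : ℕ → V → ℕ) (n : ℕ) :
    ∑ v, E.evictSum f n v =
      ∑ t ∈ Finset.range n, cntSum (f t) (E.cache t \ E.cache (t + 1)) := by
  simp only [evictSum, cntSum_eq_sum_ite, Set.mem_sdiff]
  rw [Finset.sum_comm]

theorem mul_sum_fetchSum_one_le (E : TCPhase T α req) (n : ℕ) :
    α * ∑ v, E.fetchSum (fun _ _ => 1) n v ≤ ∑ v, E.fetchSum E.cnt n v := by
  rw [sum_fetchSum, sum_fetchSum, Finset.mul_sum]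
  refine Finset.sum_le_sum fun t _ => ?_
  rw [← ncard_eq_cntSum]
  rcases E.chg_cases t with ⟨-, h, -⟩ | ⟨X, hX, ⟨-, h, -⟩ | ⟨-, h, -⟩⟩
  · simp [h]
  · rw [h, mul_comm]
    exact (E.step_some t X hX).2.1
  · simp [h]

theorem mul_sum_evictSum_kept_le (E : TCPhase T α req) (hα : 1 ≤ α) (hgood : E.GoodReq)
    {D : ℕ → Set V} (hD : ∀ t, T.Subforest (D t)) (n : ℕ) :
    α * ∑ v, E.evictSum (flag (E.kept D)) n v ≤
      ∑ v, E.evictSum (E.acc (PaidBy req D)) n v := by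
  rw [sum_evictSum, sum_evictSum, Finset.mul_sum]
  refine Finset.sum_le_sum fun t _ => ?_
  rcases E.chg_cases t with ⟨-, -, h⟩ | ⟨X, hX, ⟨-, -, h⟩ | ⟨hv, -, h⟩⟩
  · simp [h, cntSum_empty]
  · simp [h, cntSum_empty]
  · rw [h]
    refine le_of_eq_of_le ?_ (E.kept_mul_le_paid hα hgood hD hX hv)
    simp only [ncard_eq_cntSum, cntSum_eq_sum_ite, flag, Set.mem_inter_iff, ite_and]

theorem sizeFields_eq (E : TCPhase T α req) (hα : 1 ≤ α) (n : ℕ) :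
    E.sizeFields n = ∑ v, E.fetchSum (fun _ _ => 1) (n + 1) v +
      ∑ v, E.evictSum (fun _ _ => 1) (n + 1) v := by
  have hstep : ∀ t, chgSize (E.chg t) = (E.cache (t + 1) \ E.cache t).ncard +
      (E.cache t \ E.cache (t + 1)).ncard := by
    intro t
    rcases E.chg_cases t with ⟨h, h1, h2⟩ | ⟨X, h, ⟨-, h1, h2⟩ | ⟨-, h1, h2⟩⟩ <;>
      simp [h, h1, h2, chgSize]
  have h0 : chgSize (E.chg 0) = 0 := by simp [E.chg_zero hα, chgSize]
  rw [sum_fetchSum, sum_evictSum, ← Finset.sum_add_distrib]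
  simp only [← ncard_eq_cntSum, ← hstep]
  rw [Finset.range_eq_Ico, Finset.sum_eq_sum_Ico_succ_bot (by omega), h0, zero_add]
  rfl

theorem fetchSum_one_eq (E : TCPhase T α req) (n : ℕ) (v : V) :
    E.fetchSum (fun _ _ => 1) n v =
      E.evictSum (fun _ _ => 1) n v + if v ∈ E.cache n then 1 else 0 := by
  induction n with
  | zero => simp [fetchSum, evictSum, E.cache_zero]
  | succ n ih =>
    rw [fetchSum_succ, evictSum_succ, ih]
    by_cases h1 : v ∈ E.cache n <;> by_cases h2 : v ∈ E.cache (n + 1) <;> simp [h1, h2]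

theorem sum_paid_eq_serveCost (req : ℕ → Request V) (D : ℕ → Set V) (n : ℕ) :
    (∑ v, ∑ t ∈ Finset.Icc 1 n, if (req t).1 = v ∧ PaidBy req D t then 1 else 0) =
      serveCost req D 1 n := by
  rw [Finset.sum_comm, serveCost, Finset.card_filter]
  refine Finset.sum_congr rfl fun t _ => ?_
  by_cases h : PaidBy req D t
  · simp [h, show Costly (req t) (D t) from h]
  · simp [h, show ¬ Costly (req t) (D t) from h]

theorem sum_cntSum_subtree_le (T : RTree V) (f : V → ℕ) :
    ∑ v, cntSum f (T.subtree v) ≤ T.height * ∑ w, f w := by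
  simp only [cntSum_eq_sum_ite]
  rw [Finset.sum_comm, Finset.mul_sum]
  refine Finset.sum_le_sum fun w _ => ?_
  refine le_trans (le_of_eq ?_) (Nat.mul_le_mul_right (f w) (T.card_ancestors_le_height w))
  rw [Finset.sum_mul]
  simp only [ite_mul, one_mul, zero_mul]

/-- Every schedule, whatever its initial cache, pays at least `1 / h(T)` times the cost of the
fetches of `TC`, minus `α` for each node in the final cache of `TC`. -/
theorem mul_fetches_le (E : TCPhase T α req) (hα : 1 ≤ α) (hgood : E.GoodReq)
    {D : ℕ → Set V} (hD : ∀ t, T.Subforest (D t)) (n : ℕ) :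
    α * ∑ v, E.fetchSum (fun _ _ => 1) (n + 1) v ≤
      T.height * (serveCost req D 1 n + moveCost α D 1 n + α * E.kP n) := by
  have hpaid : ∑ v, E.fetchSum (E.acc (PaidBy req D)) (n + 1) v +
      ∑ v, E.evictSum (E.acc (PaidBy req D)) (n + 1) v ≤ serveCost req D 1 n := by
    rw [← sum_paid_eq_serveCost, ← Finset.sum_add_distrib]
    refine Finset.sum_le_sum fun v _ => le_trans ?_ (E.fetchSum_add_evictSum_acc_le _ n v)
    rw [fetchSum_succ, evictSum_succ]
    split_ifs <;> first | omega | tauto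
  have hsplit : ∑ v, E.fetchSum E.cnt (n + 1) v =
      ∑ v, E.fetchSum (E.acc (PaidBy req D)) (n + 1) v +
        ∑ v, E.fetchSum (E.acc fun r => ¬ PaidBy req D r) (n + 1) v := by
    simp only [sum_fetchSum, ← Finset.sum_add_distrib, ← cntSum_add]
    refine Finset.sum_congr rfl fun t _ => cntSum_congr fun v _ => ?_
    exact E.cnt_eq_acc_add_acc hgood _ t v
  have hunpaid : ∑ v, E.fetchSum (E.acc fun r => ¬ PaidBy req D r) (n + 1) v ≤
      T.height * (α * ∑ w, E.fetchSum (flag (E.touched D)) (n + 1) w) := by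
    calc _ ≤ ∑ v, α * cntSum (E.fetchSum (flag (E.touched D)) (n + 1)) (T.subtree v) :=
          Finset.sum_le_sum fun v _ => (E.fetchSum_unpaid_le hα hgood hD v (n + 1)).1
      _ = α * ∑ v, cntSum (E.fetchSum (flag (E.touched D)) (n + 1)) (T.subtree v) :=
          (Finset.mul_sum _ _ _).symm
      _ ≤ α * (T.height * _) := Nat.mul_le_mul_left _ (sum_cntSum_subtree_le T _)
      _ = _ := by ring
  have htouched : α * ∑ w, E.fetchSum (flag (E.touched D)) (n + 1) w ≤
      ∑ v, E.evictSum (E.acc (PaidBy req D)) (n + 1) v + moveCost α D 1 n + α * E.kP n := by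
    have hsum := Finset.sum_le_sum fun v (_ : v ∈ Finset.univ) => E.fetchSum_touched_le hα D v n
    have hk : E.kP n = ∑ v, if v ∈ E.cache (n + 1) then 1 else 0 := by
      rw [kP, ncard_eq_cntSum, cntSum_eq_sum_ite]
    rw [Finset.sum_add_distrib, Finset.sum_add_distrib, ← hk] at hsum
    have := Nat.mul_le_mul_left α hsum
    rw [mul_add, mul_add] at this
    have := E.mul_sum_evictSum_kept_le hα hgood hD (n + 1)
    have := mul_sum_schedEvict_le α D n
    omega
  have hh : 1 ≤ T.height := Nat.succ_le_succ (Nat.zero_le _)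
  have hcnt := E.mul_sum_fetchSum_one_le (n + 1)
  nlinarith [Nat.mul_le_mul_left T.height htouched, Nat.mul_le_mul_left T.height hpaid,
    Nat.mul_le_mul_right (∑ v, E.fetchSum (E.acc (PaidBy req D)) (n + 1) v) hh]

end TCPhase

/-- for any phase `P` of `TC` (with `α` even),
`OPT(P) ≥ (size(𝓕)/(4·h(T)) − k_P)·α/2`, where `OPT(P)` is the optimal offline cost
of serving the requests of `P` with cache size `kOPT`, starting from an arbitrary
cache. -/
theorem opt_phase_lower_bound {V : Type} [Fintype V] [DecidableEq V]
    {T : RTree V} {α : ℕ} {req : ℕ → Request V}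
    (E : TCPhase T α req) (hα : 1 ≤ α) (heven : Even α) (hgood : E.GoodReq)
    (kONL kOPT tEnd : ℕ) (hend : E.PhaseEnd kONL tEnd) :
    ((E.sizeFields tEnd : ℝ) / (4 * (T.height : ℝ)) - (E.kP tEnd : ℝ)) * (α : ℝ) / 2 ≤
      (optCostFrom T α kOPT req 1 tEnd : ℝ) := by
  obtain ⟨D, hD, hopt⟩ : optCostFrom T α kOPT req 1 tEnd ∈
      {n | ∃ D : ℕ → Set V, IsSchedule T kOPT D ∧
        n = serveCost req D 1 tEnd + moveCost α D 1 tEnd} :=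
    Nat.sInf_mem ⟨_, fun _ => ∅, fun _ => ⟨RTree.subforest_empty, by simp⟩, rfl⟩
  have hfetch := E.mul_fetches_le hα hgood (fun t => (hD t).1) tEnd
  rw [← hopt] at hfetch
  have hsize : E.sizeFields tEnd ≤ 2 * ∑ v, E.fetchSum (fun _ _ => 1) (tEnd + 1) v := by
    have : ∑ v, E.evictSum (fun _ _ => 1) (tEnd + 1) v ≤
        ∑ v, E.fetchSum (fun _ _ => 1) (tEnd + 1) v :=
      Finset.sum_le_sum fun v _ => by
        rw [E.fetchSum_one_eq]
        exact Nat.le_add_right _ _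
    rw [E.sizeFields_eq hα]
    omega
  have hmain : E.sizeFields tEnd * α ≤
      2 * T.height * (optCostFrom T α kOPT req 1 tEnd + α * E.kP tEnd) := by
    nlinarith [Nat.mul_le_mul_right α hsize]
  have hh : (0 : ℝ) < T.height := Nat.cast_pos.2 (Nat.succ_pos _)
  have hmain' : (E.sizeFields tEnd : ℝ) * α ≤
      2 * T.height * (optCostFrom T α kOPT req 1 tEnd + α * E.kP tEnd) := by
    exact_mod_cast hmain
  have hdiv : (E.sizeFields tEnd : ℝ) / (4 * T.height) * α ≤
      (optCostFrom T α kOPT req 1 tEnd + α * E.kP tEnd) / 2 := by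
    rw [div_mul_eq_mul_div, div_le_iff₀ (by positivity)]
    linarith
  have h₁ : (0 : ℝ) ≤ optCostFrom T α kOPT req 1 tEnd := Nat.cast_nonneg _
  have h₂ : (0 : ℝ) ≤ α * E.kP tEnd := by positivity
  linarith
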